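/- Let H be a quasi-Hopf algebra over a field k with Drinfeld twist inverse f⁻¹ = ∑g¹⊗g², and set q_R = ∑q¹⊗q² = ∑Q¹⊗Q² = ∑X¹⊗S⁻¹(αX³)X². Then (id⊗Δ)(q_R) = ∑ Q¹Y¹x¹₁ ⊗ S⁻¹(x³g²)Q²q¹Y²₁x¹_(2,1) ⊗ S⁻¹(Y³x²g¹)q²Y²₂x¹_(2,2), where Φ = ∑Y¹⊗Y²⊗Y³, Φ⁻¹ = ∑x¹⊗x²⊗x³, Δ(x¹)=∑x¹₁⊗x¹₂, (id⊗Δ)(Δ(x¹)) = ∑x¹₁⊗x¹_(2,1)⊗x¹_(2,2), and Δ(Y²)=∑Y²₁⊗Y²₂. -/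

import Mathlib

open scoped TensorProduct

noncomputable section

/-- A quasi-bialgebra `(H, Δ, ε, Φ)` over a field `k`.  The comultiplication is
given both as an algebra map `Δmap : H →ₐ[k] H ⊗[k] H` and by a finite family of
Sweedler components `Δ1, Δ2` (linked by `Δ_eq`); the reassociator `Φ` and its
inverse are given by finite families of components `X1, X2, X3` resp. `x1, x2, x3`. -/
structure QuasiBialgebra (k H : Type) [Field k] [Ring H] [Algebra k H] where
  /-- index type for the Sweedler components of `Δ` -/
  J : Type
  [fJ : Fintype J]
  Δ1 : H → J → H
  Δ2 : H → J → H
  Δmap : H →ₐ[k] H ⊗[k] H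
  ε : H →ₐ[k] k
  Δ_eq : ∀ h, Δmap h = ∑ j, Δ1 h j ⊗ₜ[k] Δ2 h j
  /-- index type for the components of `Φ` -/
  I : Type
  [fI : Fintype I]
  X1 : I → H
  X2 : I → H
  X3 : I → H
  /-- index type for the components of `Φ⁻¹` -/
  I' : Type
  [fI' : Fintype I']
  x1 : I' → H
  x2 : I' → H
  x3 : I' → H
  Φ_right_inv :
    (∑ i, X1 i ⊗ₜ[k] (X2 i ⊗ₜ[k] X3 i)) * (∑ a, x1 a ⊗ₜ[k] (x2 a ⊗ₜ[k] x3 a)) = 1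
  Φ_left_inv :
    (∑ a, x1 a ⊗ₜ[k] (x2 a ⊗ₜ[k] x3 a)) * (∑ i, X1 i ⊗ₜ[k] (X2 i ⊗ₜ[k] X3 i)) = 1
  quasi_coassoc : ∀ h,
    ∑ j, ∑ j', Δ1 h j ⊗ₜ[k] (Δ1 (Δ2 h j) j' ⊗ₜ[k] Δ2 (Δ2 h j) j')
      = (∑ i, X1 i ⊗ₜ[k] (X2 i ⊗ₜ[k] X3 i))
        * (∑ j, ∑ j', Δ1 (Δ1 h j) j' ⊗ₜ[k] (Δ2 (Δ1 h j) j' ⊗ₜ[k] Δ2 h j))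
        * (∑ a, x1 a ⊗ₜ[k] (x2 a ⊗ₜ[k] x3 a))
  counit_right : ∀ h, ∑ j, ε (Δ2 h j) • Δ1 h j = h
  counit_left : ∀ h, ∑ j, ε (Δ1 h j) • Δ2 h j = h
  cocycle :
    (∑ i, (1 : H) ⊗ₜ[k] (X1 i ⊗ₜ[k] (X2 i ⊗ₜ[k] X3 i)))
      * (∑ i, ∑ j, X1 i ⊗ₜ[k] (Δ1 (X2 i) j ⊗ₜ[k] (Δ2 (X2 i) j ⊗ₜ[k] X3 i)))
      * (∑ i, X1 i ⊗ₜ[k] (X2 i ⊗ₜ[k] (X3 i ⊗ₜ[k] (1 : H))))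
    = (∑ i, ∑ j, X1 i ⊗ₜ[k] (X2 i ⊗ₜ[k] (Δ1 (X3 i) j ⊗ₜ[k] Δ2 (X3 i) j)))
      * (∑ i, ∑ j, Δ1 (X1 i) j ⊗ₜ[k] (Δ2 (X1 i) j ⊗ₜ[k] (X2 i ⊗ₜ[k] X3 i)))
  Φ_normal : ∑ i, ε (X2 i) • (X1 i ⊗ₜ[k] X3 i) = (1 : H ⊗[k] H)

attribute [instance] QuasiBialgebra.fJ QuasiBialgebra.fI QuasiBialgebra.fI'

/-- A quasi-Hopf algebra: a quasi-bialgebra together with a bijective algebra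
anti-automorphism `S` (with inverse `Sinv`) and elements `α, β` satisfying the
antipode axioms. -/
structure QuasiHopf (k H : Type) [Field k] [Ring H] [Algebra k H] extends
    QuasiBialgebra k H where
  S : H →ₗ[k] H
  Sinv : H →ₗ[k] H
  Sinv_S : ∀ h, Sinv (S h) = h
  S_Sinv : ∀ h, S (Sinv h) = h
  S_one : S 1 = 1
  S_mul : ∀ a b, S (a * b) = S b * S a
  α : H
  β : H
  antipode₁ : ∀ h, ∑ j, S (Δ1 h j) * α * Δ2 h j = ε h • α
  antipode₂ : ∀ h, ∑ j, Δ1 h j * β * S (Δ2 h j) = ε h • β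
  antipode₃ : ∑ i, X1 i * β * S (X2 i) * α * X3 i = 1
  antipode₄ : ∑ a, S (x1 a) * α * x2 a * β * S (x3 a) = 1

namespace QuasiHopf

variable {k H : Type} [Field k] [Ring H] [Algebra k H] (Q : QuasiHopf k H)

/-- index type for `∑ A¹⊗A²⊗A³⊗A⁴ = (Φ⊗1)(Δ⊗id⊗id)(Φ⁻¹)` -/
abbrev AIdx := Q.I × Q.I' × Q.J

def A1 (t : Q.AIdx) : H := Q.X1 t.1 * Q.Δ1 (Q.x1 t.2.1) t.2.2
def A2 (t : Q.AIdx) : H := Q.X2 t.1 * Q.Δ2 (Q.x1 t.2.1) t.2.2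
def A3 (t : Q.AIdx) : H := Q.X3 t.1 * Q.x2 t.2.1
def A4 (t : Q.AIdx) : H := Q.x3 t.2.1

/-- index type for `∑ B¹⊗B²⊗B³⊗B⁴ = (Δ⊗id⊗id)(Φ)(Φ⁻¹⊗1)` -/
abbrev BIdx := Q.I × Q.J × Q.I'

def B1 (t : Q.BIdx) : H := Q.Δ1 (Q.X1 t.1) t.2.1 * Q.x1 t.2.2
def B2 (t : Q.BIdx) : H := Q.Δ2 (Q.X1 t.1) t.2.1 * Q.x2 t.2.2
def B3 (t : Q.BIdx) : H := Q.X2 t.1 * Q.x3 t.2.2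
def B4 (t : Q.BIdx) : H := Q.X3 t.1

/-- `γ = ∑ S(A²)αA³ ⊗ S(A¹)αA⁴` -/
def gam1 (t : Q.AIdx) : H := Q.S (Q.A2 t) * Q.α * Q.A3 t
def gam2 (t : Q.AIdx) : H := Q.S (Q.A1 t) * Q.α * Q.A4 t

/-- `δ = ∑ B¹βS(B⁴) ⊗ B²βS(B³)` -/
def del1 (t : Q.BIdx) : H := Q.B1 t * Q.β * Q.S (Q.B4 t)
def del2 (t : Q.BIdx) : H := Q.B2 t * Q.β * Q.S (Q.B3 t)

/-- index type for the components of the Drinfeld twist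
`f = ∑ (S⊗S)(Δᵒᵖ(x¹)) γ Δ(x²βS(x³))` -/
abbrev FIdx := Q.I' × Q.J × Q.AIdx × Q.J

def f1 (t : Q.FIdx) : H :=
  Q.S (Q.Δ2 (Q.x1 t.1) t.2.1) * Q.gam1 t.2.2.1
    * Q.Δ1 (Q.x2 t.1 * Q.β * Q.S (Q.x3 t.1)) t.2.2.2
def f2 (t : Q.FIdx) : H :=
  Q.S (Q.Δ1 (Q.x1 t.1) t.2.1) * Q.gam2 t.2.2.1
    * Q.Δ2 (Q.x2 t.1 * Q.β * Q.S (Q.x3 t.1)) t.2.2.2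

/-- index type for the components of
`f⁻¹ = ∑ Δ(S(x¹)αx²) δ (S⊗S)(Δᵒᵖ(x³))` -/
abbrev GIdx := Q.I' × Q.J × Q.BIdx × Q.J

def g1 (t : Q.GIdx) : H :=
  Q.Δ1 (Q.S (Q.x1 t.1) * Q.α * Q.x2 t.1) t.2.1 * Q.del1 t.2.2.1
    * Q.S (Q.Δ2 (Q.x3 t.1) t.2.2.2)
def g2 (t : Q.GIdx) : H :=
  Q.Δ2 (Q.S (Q.x1 t.1) * Q.α * Q.x2 t.1) t.2.1 * Q.del2 t.2.2.1
    * Q.S (Q.Δ1 (Q.x3 t.1) t.2.2.2)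

/-- `q_R = ∑ X¹ ⊗ S⁻¹(αX³)X²` -/
def q1 (i : Q.I) : H := Q.X1 i
def q2 (i : Q.I) : H := Q.Sinv (Q.α * Q.X3 i) * Q.X2 i

/-- `p_R = ∑ x¹ ⊗ x²βS(x³)` -/
def p1 (a : Q.I') : H := Q.x1 a
def p2 (a : Q.I') : H := Q.x2 a * Q.β * Q.S (Q.x3 a)

/-- `p_L = ∑ X²S⁻¹(X¹β) ⊗ X³` -/
def pL1 (i : Q.I) : H := Q.X2 i * Q.Sinv (Q.X1 i * Q.β)
def pL2 (i : Q.I) : H := Q.X3 i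

/-- `q_L = ∑ S(x¹)αx² ⊗ x³` -/
def qL1 (a : Q.I') : H := Q.S (Q.x1 a) * Q.α * Q.x2 a
def qL2 (a : Q.I') : H := Q.x3 a

end QuasiHopf

namespace QuasiHopf

section Induction

variable {k A B C D : Type} [Field k] [Ring A] [Algebra k A] [Ring B] [Algebra k B]
  [Ring C] [Algebra k C] [Ring D] [Algebra k D]

theorem induction_tmul {motive : A ⊗[k] B → Prop} (tmul : ∀ a b, motive (a ⊗ₜ b))
    (add : ∀ s t, motive s → motive t → motive (s + t)) (t : A ⊗[k] B) : motive t :=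
  t.induction_on (by simpa using tmul 0 0) tmul add

theorem induction_tmul₃ {motive : A ⊗[k] (B ⊗[k] C) → Prop}
    (tmul : ∀ a b c, motive (a ⊗ₜ (b ⊗ₜ c)))
    (add : ∀ s t, motive s → motive t → motive (s + t)) (t : A ⊗[k] (B ⊗[k] C)) : motive t := by
  induction t using induction_tmul with
  | tmul a u =>
    induction u using induction_tmul with
    | tmul b c => exact tmul a b c
    | add s t hs ht => rw [TensorProduct.tmul_add]; exact add _ _ hs ht
  | add s t hs ht => exact add _ _ hs ht

theorem induction_tmul₄ {motive : A ⊗[k] (B ⊗[k] (C ⊗[k] D)) → Prop}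
    (tmul : ∀ a b c d, motive (a ⊗ₜ (b ⊗ₜ (c ⊗ₜ d))))
    (add : ∀ s t, motive s → motive t → motive (s + t))
    (t : A ⊗[k] (B ⊗[k] (C ⊗[k] D))) : motive t := by
  induction t using induction_tmul with
  | tmul a u =>
    induction u using induction_tmul₃ with
    | tmul b c d => exact tmul a b c d
    | add s t hs ht => rw [TensorProduct.tmul_add]; exact add _ _ hs ht
  | add s t hs ht => exact add _ _ hs ht

end Induction

section Convolution

variable {k B X Y : Type} [Field k] [Ring B] [Algebra k B] [AddCommGroup X] [Module k X]
  [AddCommGroup Y] [Module k Y]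

/-- The linear map `x ⊗ y ↦ p x * q y`. -/
def conv (p : X →ₗ[k] B) (q : Y →ₗ[k] B) : X ⊗[k] Y →ₗ[k] B :=
  LinearMap.mul' k B ∘ₗ TensorProduct.map p q

@[simp]
theorem conv_tmul (p : X →ₗ[k] B) (q : Y →ₗ[k] B) (x : X) (y : Y) :
    conv p q (x ⊗ₜ y) = p x * q y := by
  simp [conv]

/-- The linear map `x ↦ c * p x`. -/
def lscale (c : B) (p : X →ₗ[k] B) : X →ₗ[k] B := LinearMap.mulLeft k c ∘ₗ p

@[simp]
theorem lscale_apply (c : B) (p : X →ₗ[k] B) (x : X) : lscale c p x = c * p x := rfl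

end Convolution

variable {k H : Type} [Field k] [Ring H] [Algebra k H] (Q : QuasiHopf k H)

/-- The regrouping `(a ⊗ b) ⊗ x ↦ a ⊗ (b ⊗ x)`. -/
abbrev regroup (k H X : Type) [Field k] [Ring H] [Algebra k H] [Ring X] [Algebra k X] :
    (H ⊗[k] H) ⊗[k] X →ₐ[k] H ⊗[k] (H ⊗[k] X) :=
  (Algebra.TensorProduct.assoc k k k H H X).toAlgHom

theorem regroup_tmul {X : Type} [Ring X] [Algebra k X] (a b : H) (x : X) :
    regroup k H X ((a ⊗ₜ b) ⊗ₜ x) = a ⊗ₜ (b ⊗ₜ x) := rfl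

theorem regroup_mul {X : Type} [Ring X] [Algebra k X] (s t : H ⊗[k] H) (x y : X) :
    regroup k H X ((s * t) ⊗ₜ (x * y)) = regroup k H X (s ⊗ₜ x) * regroup k H X (t ⊗ₜ y) := by
  rw [← map_mul, Algebra.TensorProduct.tmul_mul_tmul]

/-- The reassociator. -/
def assoc : H ⊗[k] (H ⊗[k] H) := ∑ i, Q.X1 i ⊗ₜ[k] (Q.X2 i ⊗ₜ[k] Q.X3 i)

/-- The inverse of the reassociator. -/
def assocInv : H ⊗[k] (H ⊗[k] H) := ∑ a, Q.x1 a ⊗ₜ[k] (Q.x2 a ⊗ₜ[k] Q.x3 a)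

/-- The reassociator as a unit. -/
def assocUnit : (H ⊗[k] (H ⊗[k] H))ˣ where
  val := Q.assoc
  inv := Q.assocInv
  val_inv := Q.Φ_right_inv
  inv_val := Q.Φ_left_inv

/-- `Δ ⊗ id` -/
def comulL : H ⊗[k] H →ₐ[k] H ⊗[k] (H ⊗[k] H) :=
  (regroup k H H).comp (Algebra.TensorProduct.map Q.Δmap (AlgHom.id k H))

/-- `id ⊗ Δ` -/
def comulR : H ⊗[k] H →ₐ[k] H ⊗[k] (H ⊗[k] H) :=
  Algebra.TensorProduct.map (AlgHom.id k H) Q.Δmap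

/-- `Δ ⊗ id ⊗ id` -/
def comul₁ : H ⊗[k] (H ⊗[k] H) →ₐ[k] H ⊗[k] (H ⊗[k] (H ⊗[k] H)) :=
  (regroup k H (H ⊗[k] H)).comp (Algebra.TensorProduct.map Q.Δmap (AlgHom.id k (H ⊗[k] H)))

/-- `id ⊗ Δ ⊗ id` -/
def comul₂ : H ⊗[k] (H ⊗[k] H) →ₐ[k] H ⊗[k] (H ⊗[k] (H ⊗[k] H)) :=
  Algebra.TensorProduct.map (AlgHom.id k H) Q.comulL

/-- `id ⊗ id ⊗ Δ` -/
def comul₃ : H ⊗[k] (H ⊗[k] H) →ₐ[k] H ⊗[k] (H ⊗[k] (H ⊗[k] H)) :=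
  Algebra.TensorProduct.map (AlgHom.id k H) Q.comulR

/-- `t ↦ 1 ⊗ t` -/
def padL (k H : Type) [Field k] [Ring H] [Algebra k H] :
    H ⊗[k] (H ⊗[k] H) →ₐ[k] H ⊗[k] (H ⊗[k] (H ⊗[k] H)) :=
  Algebra.TensorProduct.includeRight

/-- `t ↦ t ⊗ 1` -/
def padR (k H : Type) [Field k] [Ring H] [Algebra k H] :
    H ⊗[k] (H ⊗[k] H) →ₐ[k] H ⊗[k] (H ⊗[k] (H ⊗[k] H)) :=
  Algebra.TensorProduct.map (AlgHom.id k H)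
    (Algebra.TensorProduct.map (AlgHom.id k H) Algebra.TensorProduct.includeLeft)

@[simp] theorem comulL_tmul (a b : H) :
    Q.comulL (a ⊗ₜ b) = regroup k H H (Q.Δmap a ⊗ₜ b) := rfl

@[simp] theorem comulR_tmul (a b : H) : Q.comulR (a ⊗ₜ b) = a ⊗ₜ Q.Δmap b := rfl

@[simp] theorem comul₁_tmul (a : H) (t : H ⊗[k] H) :
    Q.comul₁ (a ⊗ₜ t) = regroup k H (H ⊗[k] H) (Q.Δmap a ⊗ₜ t) := rfl

@[simp] theorem comul₂_tmul (a : H) (t : H ⊗[k] H) :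
    Q.comul₂ (a ⊗ₜ t) = a ⊗ₜ Q.comulL t := rfl

@[simp] theorem comul₃_tmul (a : H) (t : H ⊗[k] H) :
    Q.comul₃ (a ⊗ₜ t) = a ⊗ₜ Q.comulR t := rfl

@[simp] theorem padL_apply (t : H ⊗[k] (H ⊗[k] H)) : padL k H t = 1 ⊗ₜ t := rfl

@[simp] theorem padR_tmul (a b c : H) :
    padR k H (a ⊗ₜ (b ⊗ₜ c)) = a ⊗ₜ (b ⊗ₜ (c ⊗ₜ 1)) := rfl

theorem coassoc (h : H) :
    Q.comulR (Q.Δmap h) * Q.assoc = Q.assoc * Q.comulL (Q.Δmap h) := by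
  have h₁ : Q.comulR (Q.Δmap h)
      = ∑ j, ∑ j', Q.Δ1 h j ⊗ₜ[k] (Q.Δ1 (Q.Δ2 h j) j' ⊗ₜ[k] Q.Δ2 (Q.Δ2 h j) j') := by
    simp only [Q.Δ_eq h, map_sum, comulR_tmul, Q.Δ_eq, TensorProduct.tmul_sum]
  have h₂ : Q.comulL (Q.Δmap h)
      = ∑ j, ∑ j', Q.Δ1 (Q.Δ1 h j) j' ⊗ₜ[k] (Q.Δ2 (Q.Δ1 h j) j' ⊗ₜ[k] Q.Δ2 h j) := by
    simp only [Q.Δ_eq h, map_sum, comulL_tmul, Q.Δ_eq, TensorProduct.sum_tmul, regroup_tmul]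
  have h₃ := Q.quasi_coassoc h
  rw [← h₁, ← h₂] at h₃
  exact (Units.eq_mul_inv_iff_mul_eq Q.assocUnit).mp h₃

theorem coassoc_inv (h : H) :
    Q.comulL (Q.Δmap h) * Q.assocInv = Q.assocInv * Q.comulR (Q.Δmap h) :=
  ((SemiconjBy.units_inv_symm_left_iff (a := Q.assocUnit)).mpr (Q.coassoc h).symm).symm

theorem pentagon :
    padL k H Q.assoc * Q.comul₂ Q.assoc * padR k H Q.assoc = Q.comul₃ Q.assoc * Q.comul₁ Q.assoc := by
  have h := Q.cocycle
  simpa only [assoc, map_sum, padL_apply, comul₂_tmul, comulL_tmul, Q.Δ_eq, TensorProduct.sum_tmul,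
    TensorProduct.tmul_sum, regroup_tmul, padR_tmul, comul₃_tmul, comulR_tmul, comul₁_tmul] using h

theorem units_pentagon :
    Units.map (padL k H).toMonoidHom Q.assocUnit * Units.map Q.comul₂.toMonoidHom Q.assocUnit
        * Units.map (padR k H).toMonoidHom Q.assocUnit
      = Units.map Q.comul₃.toMonoidHom Q.assocUnit * Units.map Q.comul₁.toMonoidHom Q.assocUnit :=
  Units.ext Q.pentagon

theorem pentagon_inv :
    padR k H Q.assocInv * Q.comul₂ Q.assocInv * padL k H Q.assocInv
      = Q.comul₁ Q.assocInv * Q.comul₃ Q.assocInv := by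
  have h := congrArg (fun u => u⁻¹) Q.units_pentagon
  simp only [mul_inv_rev, ← mul_assoc] at h
  exact congrArg Units.val h

theorem padR_mul_comul₁_inv :
    padR k H Q.assoc * Q.comul₁ Q.assocInv
      = Q.comul₂ Q.assocInv * (padL k H Q.assocInv * Q.comul₃ Q.assoc) := by
  have h := Q.units_pentagon
  rw [mul_assoc, ← eq_inv_mul_iff_mul_eq, ← eq_inv_mul_iff_mul_eq, ← mul_assoc, ← mul_assoc,
    ← mul_inv_eq_iff_eq_mul, mul_assoc] at h
  exact congrArg Units.val h

theorem comul₃_inv_mul_padL :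
    Q.comul₃ Q.assocInv * padL k H Q.assoc
      = Q.comul₁ Q.assoc * padR k H Q.assocInv * Q.comul₂ Q.assocInv := by
  have h := Q.units_pentagon
  rw [← eq_mul_inv_iff_mul_eq, ← eq_mul_inv_iff_mul_eq, mul_assoc, mul_assoc,
    ← inv_mul_eq_iff_eq_mul, ← mul_assoc] at h
  exact congrArg Units.val h

theorem comul₁_mul_padR_inv :
    Q.comul₁ Q.assoc * padR k H Q.assocInv
      = Q.comul₃ Q.assocInv * padL k H Q.assoc * Q.comul₂ Q.assoc := by
  have h := Q.units_pentagon
  rw [← eq_mul_inv_iff_mul_eq, mul_assoc (Units.map Q.comul₃.toMonoidHom _),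
    ← inv_mul_eq_iff_eq_mul, ← mul_assoc] at h
  exact congrArg Units.val h.symm

theorem comul₃_mul_comul₁_mul_padR_inv :
    Q.comul₃ Q.assoc * (Q.comul₁ Q.assoc * padR k H Q.assocInv)
      = padL k H Q.assoc * Q.comul₂ Q.assoc := by
  have h := Q.units_pentagon
  rw [← eq_mul_inv_iff_mul_eq, mul_assoc (Units.map Q.comul₃.toMonoidHom _)] at h
  exact congrArg Units.val h.symm

theorem padL_inv_mul_comul₃ :
    padL k H Q.assocInv * Q.comul₃ Q.assoc
      = Q.comul₂ Q.assoc * padR k H Q.assoc * Q.comul₁ Q.assocInv := by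
  have h := Q.units_pentagon
  rw [mul_assoc, ← eq_inv_mul_iff_mul_eq, ← mul_assoc, ← mul_inv_eq_iff_eq_mul] at h
  exact congrArg Units.val h.symm

section Counit

set_option maxSynthPendingDepth 6

/-- `ε ⊗ id` -/
def counitL (X : Type) [Ring X] [Algebra k X] : H ⊗[k] X →ₐ[k] X :=
  (Algebra.TensorProduct.lid k X).toAlgHom.comp (Algebra.TensorProduct.map Q.ε (AlgHom.id k X))

/-- `id ⊗ ε` -/
def counitR : H ⊗[k] H →ₐ[k] H :=
  (Algebra.TensorProduct.rid k k H).toAlgHom.comp (Algebra.TensorProduct.map (AlgHom.id k H) Q.ε)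

/-- `id ⊗ ε ⊗ id` -/
def counit₂ : H ⊗[k] (H ⊗[k] H) →ₐ[k] H ⊗[k] H :=
  Algebra.TensorProduct.map (AlgHom.id k H) (Q.counitL H)

/-- `id ⊗ id ⊗ ε` -/
def counit₃ : H ⊗[k] (H ⊗[k] H) →ₐ[k] H ⊗[k] H :=
  Algebra.TensorProduct.map (AlgHom.id k H) Q.counitR

@[simp] theorem counitL_tmul {X : Type} [Ring X] [Algebra k X] (a : H) (x : X) :
    Q.counitL X (a ⊗ₜ x) = Q.ε a • x := rfl

@[simp] theorem counitR_tmul (a b : H) : Q.counitR (a ⊗ₜ b) = Q.ε b • a := rfl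

@[simp] theorem counit₂_tmul (a b c : H) :
    Q.counit₂ (a ⊗ₜ (b ⊗ₜ c)) = Q.ε b • (a ⊗ₜ c) := by
  simp [counit₂]

@[simp] theorem counit₃_tmul (a b c : H) :
    Q.counit₃ (a ⊗ₜ (b ⊗ₜ c)) = Q.ε c • (a ⊗ₜ b) := by
  simp [counit₃]

@[simp] theorem counitL_comul (h : H) : Q.counitL H (Q.Δmap h) = h := by
  rw [Q.Δ_eq, map_sum]
  exact Q.counit_left h

@[simp] theorem counitR_comul (h : H) : Q.counitR (Q.Δmap h) = h := by
  rw [Q.Δ_eq, map_sum]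
  exact Q.counit_right h

theorem counit₂_assoc : Q.counit₂ Q.assoc = 1 := by
  simpa only [assoc, map_sum, counit₂_tmul] using Q.Φ_normal

theorem counit₂_comul₁ (P : H ⊗[k] (H ⊗[k] H)) :
    Algebra.TensorProduct.map (AlgHom.id k H) (Q.counitL (H ⊗[k] H)) (Q.comul₁ P) = P := by
  induction P using induction_tmul with
  | tmul a t =>
    have h (s : H ⊗[k] H) : Algebra.TensorProduct.map (AlgHom.id k H) (Q.counitL (H ⊗[k] H))
        (regroup k H (H ⊗[k] H) (s ⊗ₜ t)) = Q.counitR s ⊗ₜ t := by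
      induction s using induction_tmul with
      | tmul b c => simp [TensorProduct.smul_tmul']
      | add s s' hs hs' => simp only [TensorProduct.add_tmul, map_add, hs, hs']
    rw [comul₁_tmul, h, counitR_comul]
  | add s t hs ht => simp only [map_add, hs, ht]

theorem counitL_comulL (t : H ⊗[k] H) : Q.counitL (H ⊗[k] H) (Q.comulL t) = t := by
  induction t using induction_tmul with
  | tmul a b =>
    have h (s : H ⊗[k] H) : Q.counitL (H ⊗[k] H) (regroup k H H (s ⊗ₜ b))
        = Q.counitL H s ⊗ₜ b := by
      induction s using induction_tmul with
      | tmul c d => simp [TensorProduct.smul_tmul']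
      | add s s' hs hs' => simp only [TensorProduct.add_tmul, map_add, hs, hs']
    rw [comulL_tmul, h, counitL_comul]
  | add s t hs ht => simp only [map_add, hs, ht]

theorem counit₂_comulL (t : H ⊗[k] H) : Q.counit₂ (Q.comulL t) = t := by
  induction t using induction_tmul with
  | tmul a b =>
    have h (s : H ⊗[k] H) : Q.counit₂ (regroup k H H (s ⊗ₜ b)) = Q.counitR s ⊗ₜ b := by
      induction s using induction_tmul with
      | tmul c d => simp [TensorProduct.smul_tmul']
      | add s s' hs hs' => simp only [TensorProduct.add_tmul, map_add, hs, hs']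
    rw [comulL_tmul, h, counitR_comul]
  | add s t hs ht => simp only [map_add, hs, ht]

theorem counit₂_comulR (t : H ⊗[k] H) : Q.counit₂ (Q.comulR t) = t := by
  induction t using induction_tmul with
  | tmul a b => simp [counit₂]
  | add s t hs ht => simp only [map_add, hs, ht]

theorem counitL_assoc : Q.counitL (H ⊗[k] H) Q.assoc = 1 := by
  have h := congrArg (Algebra.TensorProduct.map (AlgHom.id k H) (Q.counitL (H ⊗[k] H))) Q.pentagon
  have h₂ (P : H ⊗[k] (H ⊗[k] H)) :
      Algebra.TensorProduct.map (AlgHom.id k H) (Q.counitL (H ⊗[k] H)) (Q.comul₂ P) = P := by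
    induction P using induction_tmul with
    | tmul a t => simp [counitL_comulL]
    | add s t hs ht => simp only [map_add, hs, ht]
  have hR (P : H ⊗[k] (H ⊗[k] H)) :
      Algebra.TensorProduct.map (AlgHom.id k H) (Q.counitL (H ⊗[k] H)) (padR k H P)
        = Algebra.TensorProduct.map (AlgHom.id k H) Algebra.TensorProduct.includeLeft
          (Q.counit₂ P) := by
    induction P using induction_tmul₃ with
    | tmul a b c => simp
    | add s t hs ht => simp only [map_add, hs, ht]
  have h₃ (P : H ⊗[k] (H ⊗[k] H)) :
      Algebra.TensorProduct.map (AlgHom.id k H) (Q.counitL (H ⊗[k] H)) (Q.comul₃ P)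
        = Q.comulR (Q.counit₂ P) := by
    induction P using induction_tmul₃ with
    | tmul a b c => simp
    | add s t hs ht => simp only [map_add, hs, ht]
  simp only [map_mul, h₂, hR, h₃, counit₂_comul₁, counit₂_assoc, map_one, mul_one, one_mul] at h
  have h' := (Units.isUnit Q.assocUnit).mul_right_cancel (h.trans (one_mul Q.assoc).symm)
  simpa using congrArg (Q.counitL (H ⊗[k] H)) h'

theorem counit₃_assoc : Q.counit₃ Q.assoc = 1 := by
  have h := congrArg (Algebra.TensorProduct.map (AlgHom.id k H) Q.counit₂) Q.pentagon
  have hL (P : H ⊗[k] (H ⊗[k] H)) :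
      Algebra.TensorProduct.map (AlgHom.id k H) Q.counit₂ (padL k H P) = 1 ⊗ₜ Q.counit₂ P := rfl
  have h₁ (P : H ⊗[k] (H ⊗[k] H)) :
      Algebra.TensorProduct.map (AlgHom.id k H) Q.counit₂ (Q.comul₁ P)
        = Q.comulL (Q.counit₂ P) := by
    induction P using induction_tmul₃ with
    | tmul a b c =>
      have h (s : H ⊗[k] H) : Algebra.TensorProduct.map (AlgHom.id k H) Q.counit₂
          (regroup k H (H ⊗[k] H) (s ⊗ₜ (b ⊗ₜ c))) = Q.ε b • regroup k H H (s ⊗ₜ c) := by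
        induction s using induction_tmul with
        | tmul d e => simp
        | add s s' hs hs' => simp only [TensorProduct.add_tmul, map_add, hs, hs', smul_add]
      rw [comul₁_tmul, h, counit₂_tmul, map_smul, comulL_tmul]
    | add s t hs ht => simp only [map_add, hs, ht]
  have h₂ (P : H ⊗[k] (H ⊗[k] H)) :
      Algebra.TensorProduct.map (AlgHom.id k H) Q.counit₂ (Q.comul₂ P) = P := by
    induction P using induction_tmul with
    | tmul a t => simp [counit₂_comulL]
    | add s t hs ht => simp only [map_add, hs, ht]
  have h₃ (P : H ⊗[k] (H ⊗[k] H)) :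
      Algebra.TensorProduct.map (AlgHom.id k H) Q.counit₂ (Q.comul₃ P) = P := by
    induction P using induction_tmul with
    | tmul a t => simp [counit₂_comulR]
    | add s t hs ht => simp only [map_add, hs, ht]
  have hR (P : H ⊗[k] (H ⊗[k] H)) :
      Algebra.TensorProduct.map (AlgHom.id k H) Q.counit₂ (padR k H P)
        = Algebra.TensorProduct.map (AlgHom.id k H) Algebra.TensorProduct.includeLeft
          (Q.counit₃ P) := by
    induction P using induction_tmul₃ with
    | tmul a b c => simp
    | add s t hs ht => simp only [map_add, hs, ht]
  simp only [map_mul, hL, h₁, h₂, hR, h₃, counit₂_assoc, map_one, mul_one,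
    ← Algebra.TensorProduct.one_def, one_mul] at h
  have h' := (Units.isUnit Q.assocUnit).mul_left_cancel (h.trans (mul_one Q.assoc).symm)
  have hc (t : H ⊗[k] H) : Q.counit₃ (Algebra.TensorProduct.map (AlgHom.id k H)
      (Algebra.TensorProduct.includeLeft (R := k) (S := k) (A := H) (B := H)) t) = t := by
    induction t using induction_tmul with
    | tmul a b => simp
    | add s t hs ht => simp only [map_add, hs, ht]
  rw [← hc (Q.counit₃ Q.assoc), h', map_one]

theorem map_assocInv {X : Type} [Ring X] [Algebra k X] {f : H ⊗[k] (H ⊗[k] H) →ₐ[k] X}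
    (hf : f Q.assoc = 1) : f Q.assocInv = 1 := by
  have h : f Q.assoc * f Q.assocInv = 1 := by
    rw [← map_mul]
    exact (congrArg f Q.Φ_right_inv).trans (map_one f)
  rwa [hf, one_mul] at h

end Counit

section Antipodal

set_option maxSynthPendingDepth 6

variable {B : Type} [Ring B] [Algebra k B]

/-- An anti-multiplicative unital map `σ`. -/
structure IsAnti (σ : H →ₗ[k] B) : Prop where
  map_one : σ 1 = 1
  map_mul : ∀ a b, σ (a * b) = σ b * σ a

/-- `∑ σ(h₁) α ρ(h₂) = ε(h) α` -/
structure IsLeftAntipodal (ρ : H →ₐ[k] B) (σ : H →ₗ[k] B) (α : B) : Prop extends IsAnti σ where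
  left : ∀ h, conv σ (lscale α ρ.toLinearMap) (Q.Δmap h) = Q.ε h • α

/-- `∑ ρ(h₁) β σ(h₂) = ε(h) β` -/
structure IsRightAntipodal (ρ : H →ₐ[k] B) (σ : H →ₗ[k] B) (β : B) : Prop extends IsAnti σ where
  right : ∀ h, conv ρ.toLinearMap (lscale β σ) (Q.Δmap h) = Q.ε h • β

theorem conv_lscale_left {X Y : Type} [AddCommGroup X] [Module k X] [AddCommGroup Y] [Module k Y]
    (c : B) (p : X →ₗ[k] B) (q : Y →ₗ[k] B) (t : X ⊗[k] Y) :
    conv (lscale c p) q t = c * conv p q t := by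
  induction t using TensorProduct.induction_on with
  | zero => simp
  | tmul a b => simp [mul_assoc]
  | add s t hs ht => simp only [map_add, mul_add, hs, ht]

theorem conv_regroup {X : Type} [Ring X] [Algebra k X] (p q : H →ₗ[k] B) (r : X →ₗ[k] B)
    (t : H ⊗[k] H) (x : X) :
    conv p (conv q r) (regroup k H X (t ⊗ₜ x)) = conv p q t * r x := by
  induction t using induction_tmul with
  | tmul a b => simp [mul_assoc]
  | add s t hs ht => simp only [TensorProduct.add_tmul, map_add, add_mul, hs, ht]

variable {Q} {ρ : H →ₐ[k] B} {σ : H →ₗ[k] B} {α β : B}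

theorem IsAnti.conv_mul_tmul (h : IsAnti σ) (c : B) (t : H ⊗[k] H) (a b : H) :
    conv σ (lscale c ρ.toLinearMap) (t * (a ⊗ₜ b))
      = σ a * (conv σ (lscale c ρ.toLinearMap) t * ρ b) := by
  induction t using induction_tmul with
  | tmul c d => simp [h.map_mul, mul_assoc]
  | add s t hs ht => simp only [map_add, add_mul, mul_add, hs, ht]

theorem IsAnti.conv_tmul_mul (h : IsAnti σ) (c : B) (t : H ⊗[k] H) (a b : H) :
    conv ρ.toLinearMap (lscale c σ) ((a ⊗ₜ b) * t)
      = ρ a * (conv ρ.toLinearMap (lscale c σ) t * σ b) := by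
  induction t using induction_tmul with
  | tmul c d => simp [h.map_mul, mul_assoc]
  | add s t hs ht => simp only [map_add, add_mul, mul_add, hs, ht]

theorem IsLeftAntipodal.conv_comul_mul (h : Q.IsLeftAntipodal ρ σ α) (g : H) (t : H ⊗[k] H) :
    conv σ (lscale α ρ.toLinearMap) (Q.Δmap g * t)
      = Q.ε g • conv σ (lscale α ρ.toLinearMap) t := by
  induction t using induction_tmul with
  | tmul a b => simp [h.toIsAnti.conv_mul_tmul, h.left]
  | add s t hs ht => simp only [map_add, mul_add, smul_add, hs, ht]

theorem IsRightAntipodal.conv_mul_comul (h : Q.IsRightAntipodal ρ σ β) (g : H) (t : H ⊗[k] H) :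
    conv ρ.toLinearMap (lscale β σ) (t * Q.Δmap g)
      = Q.ε g • conv ρ.toLinearMap (lscale β σ) t := by
  induction t using induction_tmul with
  | tmul a b => simp [h.toIsAnti.conv_tmul_mul, h.right]
  | add s t hs ht => simp only [map_add, add_mul, smul_add, hs, ht]

theorem IsLeftAntipodal.conv_comul₁_mul (h : Q.IsLeftAntipodal ρ σ α)
    (R : H ⊗[k] H →ₗ[k] B) {P : H ⊗[k] (H ⊗[k] H)} (hP : Q.counitL (H ⊗[k] H) P = 1)
    (M : H ⊗[k] (H ⊗[k] (H ⊗[k] H))) :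
    conv σ (conv (lscale α ρ.toLinearMap) R) (Q.comul₁ P * M)
      = conv σ (conv (lscale α ρ.toLinearMap) R) M := by
  suffices key : conv σ (conv (lscale α ρ.toLinearMap) R) (Q.comul₁ P * M)
      = conv σ (conv (lscale α ρ.toLinearMap) R)
        ((1 ⊗ₜ (1 ⊗ₜ Q.counitL (H ⊗[k] H) P)) * M) by
    rw [key, hP, ← Algebra.TensorProduct.one_def, ← Algebra.TensorProduct.one_def, one_mul]
  clear hP
  induction P using induction_tmul with
  | tmul a t =>
    induction M using induction_tmul₃ with
    | tmul b c u =>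
      rw [comul₁_tmul, ← regroup_tmul b c, ← regroup_tmul 1 1, ← regroup_mul, ← regroup_mul,
        conv_regroup, conv_regroup, h.conv_comul_mul, ← Algebra.TensorProduct.one_def, one_mul]
      simp
    | add s t hs ht => simp only [map_add, mul_add, hs, ht]
  | add s t hs ht => simp only [map_add, TensorProduct.tmul_add, add_mul, hs, ht]

theorem IsLeftAntipodal.conv_comul₂_mul (h : Q.IsLeftAntipodal ρ σ α)
    (p R : H →ₗ[k] B) {P : H ⊗[k] (H ⊗[k] H)} (hP : Q.counit₂ P = 1)
    (M : H ⊗[k] (H ⊗[k] (H ⊗[k] H))) :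
    conv p (conv σ (conv (lscale α ρ.toLinearMap) R)) (Q.comul₂ P * M)
      = conv p (conv σ (conv (lscale α ρ.toLinearMap) R)) M := by
  suffices key : conv p (conv σ (conv (lscale α ρ.toLinearMap) R)) (Q.comul₂ P * M)
      = conv p (conv σ (conv (lscale α ρ.toLinearMap) R))
        (Algebra.TensorProduct.map (AlgHom.id k H) ((Algebra.TensorProduct.includeRight).comp
          Algebra.TensorProduct.includeRight) (Q.counit₂ P) * M) by
    rw [key, hP, map_one, one_mul]
  clear hP
  induction P using induction_tmul₃ with
  | tmul a b c =>
    induction M using induction_tmul₄ with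
    | tmul m n o q =>
      have h₁ : (1 : H) ⊗ₜ[k] ((1 : H) ⊗ₜ[k] c) = regroup k H H (1 ⊗ₜ c) := rfl
      rw [comul₂_tmul, comulL_tmul, ← regroup_tmul n o, Algebra.TensorProduct.tmul_mul_tmul,
        ← regroup_mul, conv_tmul, conv_regroup, h.conv_comul_mul, counit₂_tmul, map_smul]
      simp only [Algebra.TensorProduct.map_tmul, AlgHom.comp_apply,
        Algebra.TensorProduct.includeRight_apply, h₁, smul_mul_assoc,
        Algebra.TensorProduct.tmul_mul_tmul, ← regroup_mul, one_mul, map_smul, conv_tmul,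
        conv_regroup, AlgHom.id_apply, mul_smul_comm]
    | add s t hs ht => simp only [map_add, mul_add, hs, ht]
  | add s t hs ht => simp only [map_add, add_mul, hs, ht]

theorem IsRightAntipodal.conv_mul_comul₂ (h : Q.IsRightAntipodal ρ σ β) (c : B)
    (p R : H →ₗ[k] B) {P : H ⊗[k] (H ⊗[k] H)} (hP : Q.counit₂ P = 1)
    (M : H ⊗[k] (H ⊗[k] (H ⊗[k] H))) :
    conv p (conv (lscale c ρ.toLinearMap) (conv (lscale β σ) R)) (M * Q.comul₂ P)
      = conv p (conv (lscale c ρ.toLinearMap) (conv (lscale β σ) R)) M := by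
  suffices key : conv p (conv (lscale c ρ.toLinearMap) (conv (lscale β σ) R)) (M * Q.comul₂ P)
      = conv p (conv (lscale c ρ.toLinearMap) (conv (lscale β σ) R))
        (M * Algebra.TensorProduct.map (AlgHom.id k H) ((Algebra.TensorProduct.includeRight).comp
          Algebra.TensorProduct.includeRight) (Q.counit₂ P)) by
    rw [key, hP, map_one, mul_one]
  clear hP
  induction P using induction_tmul₃ with
  | tmul a b d =>
    induction M using induction_tmul₄ with
    | tmul m n o q =>
      have h₁ : (1 : H) ⊗ₜ[k] ((1 : H) ⊗ₜ[k] d) = regroup k H H (1 ⊗ₜ d) := rfl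
      rw [comul₂_tmul, comulL_tmul, ← regroup_tmul n o, Algebra.TensorProduct.tmul_mul_tmul,
        ← regroup_mul, conv_tmul, conv_regroup, conv_lscale_left, h.conv_mul_comul, counit₂_tmul,
        map_smul]
      simp only [Algebra.TensorProduct.map_tmul, AlgHom.comp_apply,
        Algebra.TensorProduct.includeRight_apply, h₁, smul_mul_assoc, conv_lscale_left,
        Algebra.TensorProduct.tmul_mul_tmul, ← regroup_mul, mul_one, map_smul, conv_tmul,
        conv_regroup, AlgHom.id_apply, mul_smul_comm, mul_assoc]
    | add s t hs ht => simp only [map_add, add_mul, hs, ht]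
  | add s t hs ht => simp only [map_add, mul_add, hs, ht]

theorem IsLeftAntipodal.conv_comul₃_mul (h : Q.IsLeftAntipodal ρ σ α) (c : B)
    (p q : H →ₗ[k] B) {P : H ⊗[k] (H ⊗[k] H)} (hP : Q.counit₃ P = 1)
    (M : H ⊗[k] (H ⊗[k] (H ⊗[k] H))) :
    conv p (conv q (conv (lscale c σ) (lscale α ρ.toLinearMap))) (Q.comul₃ P * M)
      = conv p (conv q (conv (lscale c σ) (lscale α ρ.toLinearMap))) M := by
  suffices key : conv p (conv q (conv (lscale c σ) (lscale α ρ.toLinearMap))) (Q.comul₃ P * M)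
      = conv p (conv q (conv (lscale c σ) (lscale α ρ.toLinearMap)))
        (Algebra.TensorProduct.map (AlgHom.id k H) Algebra.TensorProduct.includeLeft
          (Q.counit₃ P) * M) by
    rw [key, hP, map_one, one_mul]
  clear hP
  induction P using induction_tmul₃ with
  | tmul a b d =>
    induction M using induction_tmul₄ with
    | tmul m n o r =>
      simp [conv_lscale_left, h.conv_comul_mul, mul_assoc]
    | add s t hs ht => simp only [map_add, mul_add, hs, ht]
  | add s t hs ht => simp only [map_add, add_mul, hs, ht]

theorem IsRightAntipodal.conv_mul_comul₃ (h : Q.IsRightAntipodal ρ σ β) (c : B)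
    (p q : H →ₗ[k] B) {P : H ⊗[k] (H ⊗[k] H)} (hP : Q.counit₃ P = 1)
    (M : H ⊗[k] (H ⊗[k] (H ⊗[k] H))) :
    conv p (conv q (conv (lscale c ρ.toLinearMap) (lscale β σ))) (M * Q.comul₃ P)
      = conv p (conv q (conv (lscale c ρ.toLinearMap) (lscale β σ))) M := by
  suffices key : conv p (conv q (conv (lscale c ρ.toLinearMap) (lscale β σ))) (M * Q.comul₃ P)
      = conv p (conv q (conv (lscale c ρ.toLinearMap) (lscale β σ)))
        (M * Algebra.TensorProduct.map (AlgHom.id k H) Algebra.TensorProduct.includeLeft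
          (Q.counit₃ P)) by
    rw [key, hP, map_one, mul_one]
  clear hP
  induction P using induction_tmul₃ with
  | tmul a b d =>
    induction M using induction_tmul₄ with
    | tmul m n o r =>
      simp [conv_lscale_left, h.conv_mul_comul, mul_assoc]
    | add s t hs ht => simp only [map_add, add_mul, hs, ht]
  | add s t hs ht => simp only [map_add, mul_add, hs, ht]

end Antipodal

section Bridge

set_option maxSynthPendingDepth 6

variable {B : Type} [Ring B] [Algebra k B]

/-- The element `∑ σ(x¹) α ρ(x²) β τ(x³)`. -/
def bridge (ρ : H →ₐ[k] B) (σ : H →ₗ[k] B) (α β : B) (τ : H →ₗ[k] B) : B :=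
  conv σ (conv (lscale α ρ.toLinearMap) (lscale β τ)) Q.assocInv

variable {Q} {ρ : H →ₐ[k] B} {σ τ υ : H →ₗ[k] B} {α β α' : B}

theorem bridge_intertwines (hσ : Q.IsLeftAntipodal ρ σ α) (hτ : Q.IsRightAntipodal ρ τ β)
    (a : H) : σ a * Q.bridge ρ σ α β τ = Q.bridge ρ σ α β τ * τ a := by
  have hR (P : H ⊗[k] (H ⊗[k] H)) (s : H ⊗[k] H) :
      conv σ (conv (lscale α ρ.toLinearMap) (lscale β τ)) (P * Q.comulR s)
        = σ (Q.counitR s) * conv σ (conv (lscale α ρ.toLinearMap) (lscale β τ)) P := by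
    induction s using induction_tmul with
    | tmul u v =>
      induction P using induction_tmul with
      | tmul b t => simp [conv_lscale_left, hτ.conv_mul_comul, hσ.map_mul, mul_assoc]
      | add s t hs ht => simp only [map_add, add_mul, mul_add, hs, ht]
    | add s t hs ht => simp only [map_add, add_mul, mul_add, hs, ht]
  have hL (P : H ⊗[k] (H ⊗[k] H)) (s : H ⊗[k] H) :
      conv σ (conv (lscale α ρ.toLinearMap) (lscale β τ)) (Q.comulL s * P)
        = conv σ (conv (lscale α ρ.toLinearMap) (lscale β τ)) P * τ (Q.counitL H s) := by
    induction s using induction_tmul with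
    | tmul u v =>
      induction P using induction_tmul₃ with
      | tmul b c d =>
        rw [comulL_tmul, ← regroup_tmul, ← regroup_mul, conv_regroup, conv_regroup,
          hσ.conv_comul_mul]
        simp [hτ.map_mul, mul_assoc]
      | add s t hs ht => simp only [map_add, add_mul, mul_add, hs, ht]
    | add s t hs ht => simp only [map_add, add_mul, mul_add, hs, ht]
  have h := hL Q.assocInv (Q.Δmap a)
  rw [Q.coassoc_inv, hR, counitR_comul, counitL_comul] at h
  exact h

theorem bridge_mul (hσ : Q.IsLeftAntipodal ρ σ α') (hτ : Q.IsRightAntipodal ρ τ β)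
    (hτ' : Q.IsLeftAntipodal ρ τ α)
    (h : conv ρ.toLinearMap (conv (lscale β τ) (lscale α ρ.toLinearMap)) Q.assoc = 1) :
    Q.bridge ρ σ α' β τ * α = α' := by
  have hR (P : H ⊗[k] (H ⊗[k] H)) :
      conv σ (conv (lscale α' ρ.toLinearMap) (conv (lscale β τ) (lscale α ρ.toLinearMap)))
          (padR k H P)
        = conv σ (conv (lscale α' ρ.toLinearMap) (lscale β τ)) P * α := by
    induction P using induction_tmul₃ with
    | tmul b c d => simp [mul_assoc]
    | add s t hs ht => simp only [map_add, add_mul, hs, ht]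
  have key := congrArg
    (conv σ (conv (lscale α' ρ.toLinearMap) (conv (lscale β τ) (lscale α ρ.toLinearMap))))
    Q.comul₃_mul_comul₁_mul_padR_inv
  rw [hτ'.conv_comul₃_mul β _ _ Q.counit₃_assoc, hσ.conv_comul₁_mul _ Q.counitL_assoc, hR,
    hτ.conv_mul_comul₂ α' _ _ Q.counit₂_assoc, padL_apply, conv_tmul, conv_lscale_left, h,
    hσ.map_one, one_mul, mul_one] at key
  exact key

theorem bridge_mul_bridge (hσ : Q.IsLeftAntipodal ρ σ α') (hτ : Q.IsRightAntipodal ρ τ β)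
    (hτ' : Q.IsLeftAntipodal ρ τ α)
    (h : conv ρ.toLinearMap (conv (lscale β τ) (lscale α ρ.toLinearMap)) Q.assoc = 1) (β' : B) :
    Q.bridge ρ σ α' β τ * Q.bridge ρ τ α β' υ = Q.bridge ρ σ α' β' υ := by
  have key (P : H ⊗[k] (H ⊗[k] H)) :
      Q.bridge ρ σ α' β τ * conv τ (conv (lscale α ρ.toLinearMap) (lscale β' υ)) P
        = conv σ (conv (lscale α' ρ.toLinearMap) (lscale β' υ)) P := by
    induction P using induction_tmul₃ with
    | tmul a b c =>
      simp only [conv_tmul, lscale_apply]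
      rw [← mul_assoc, ← bridge_intertwines hσ hτ, mul_assoc (σ a), mul_assoc α,
        ← mul_assoc _ α, bridge_mul hσ hτ hτ' h, ← mul_assoc α']
    | add s t hs ht => simp only [map_add, mul_add, hs, ht]
  exact key Q.assocInv

/-- A left antipodal map is conjugate to any two-sided one. -/
theorem IsLeftAntipodal.apply_eq (hσ : Q.IsLeftAntipodal ρ σ α') (hτ : Q.IsRightAntipodal ρ τ β)
    (hτ' : Q.IsLeftAntipodal ρ τ α)
    (h : conv ρ.toLinearMap (conv (lscale β τ) (lscale α ρ.toLinearMap)) Q.assoc = 1) {β' : B}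
    (h' : Q.bridge ρ σ α' β' σ = 1) {a b : H} (hab : τ a = α * ρ b) :
    σ a = α' * ρ b * Q.bridge ρ τ α β' σ := by
  rw [← mul_one (σ a), ← h', ← bridge_mul_bridge hσ hτ hτ' h β', ← mul_assoc,
    bridge_intertwines hσ hτ, hab, ← mul_assoc, bridge_mul hσ hτ hτ' h]

end Bridge

section Push

variable {B : Type} [Ring B] [Algebra k B] (f : H →ₐ[k] B)

/-- The composite of the antipode with an algebra map. -/
def push : H →ₗ[k] B := f.toLinearMap ∘ₗ Q.S

@[simp]
theorem push_apply (h : H) : Q.push f h = f (Q.S h) := rfl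

theorem isAnti_push : IsAnti (Q.push f) where
  map_one := by simp [Q.S_one]
  map_mul a b := by simp [Q.S_mul]

theorem isLeftAntipodal_push : Q.IsLeftAntipodal f (Q.push f) (f Q.α) where
  toIsAnti := Q.isAnti_push f
  left h := by
    have h' := congrArg f (Q.antipode₁ h)
    simp only [map_sum, map_mul, map_smul] at h'
    simp [Q.Δ_eq h, ← h', mul_assoc]

theorem isRightAntipodal_push : Q.IsRightAntipodal f (Q.push f) (f Q.β) where
  toIsAnti := Q.isAnti_push f
  right h := by
    have h' := congrArg f (Q.antipode₂ h)
    simp only [map_sum, map_mul, map_smul] at h'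
    simp [Q.Δ_eq h, ← h', mul_assoc]

theorem conv_push_assoc :
    conv f.toLinearMap (conv (lscale (f Q.β) (Q.push f)) (lscale (f Q.α) f.toLinearMap)) Q.assoc
      = 1 := by
  have h := congrArg f Q.antipode₃
  simp only [map_sum, map_mul, map_one] at h
  simp [assoc, ← h, mul_assoc]

theorem bridge_push : Q.bridge f (Q.push f) (f Q.α) (f Q.β) (Q.push f) = 1 := by
  have h := congrArg f Q.antipode₄
  simp only [map_sum, map_mul, map_one] at h
  simp [bridge, assocInv, ← h, mul_assoc]

end Push

section Twist

set_option maxSynthPendingDepth 6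

/-- `a ⊗ b ↦ S b ⊗ S a` -/
def antiSwap : H ⊗[k] H →ₗ[k] H ⊗[k] H :=
  TensorProduct.map Q.S Q.S ∘ₗ (TensorProduct.comm k H H).toLinearMap

@[simp]
theorem antiSwap_tmul (a b : H) : Q.antiSwap (a ⊗ₜ b) = Q.S b ⊗ₜ Q.S a := rfl

theorem antiSwap_mul (s t : H ⊗[k] H) :
    Q.antiSwap (s * t) = Q.antiSwap t * Q.antiSwap s := by
  induction s using induction_tmul with
  | tmul a b =>
    induction t using induction_tmul with
    | tmul c d => simp [Q.S_mul]
    | add s t hs ht => simp only [map_add, add_mul, mul_add, hs, ht]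
  | add s t hs ht => simp only [map_add, add_mul, mul_add, hs, ht]

theorem antiSwap_injective : Function.Injective Q.antiSwap := by
  have h : Function.LeftInverse
      (TensorProduct.map Q.Sinv Q.Sinv ∘ₗ (TensorProduct.comm k H H).toLinearMap) Q.antiSwap := by
    intro t
    induction t using induction_tmul with
    | tmul a b => simp [Q.Sinv_S]
    | add s t hs ht => simp only [map_add, hs, ht]
  exact h.injective

/-- `h ↦ S h₂ ⊗ S h₁` -/
def antiComul : H →ₗ[k] H ⊗[k] H := Q.antiSwap ∘ₗ Q.Δmap.toLinearMap

theorem antiComul_apply (h : H) : Q.antiComul h = Q.antiSwap (Q.Δmap h) := rfl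

theorem isAnti_antiComul : IsAnti Q.antiComul where
  map_one := by simp [antiComul_apply, Algebra.TensorProduct.one_def, Q.S_one]
  map_mul a b := by rw [antiComul_apply, map_mul, antiSwap_mul, antiComul_apply, antiComul_apply]

theorem tmul_mul_tmul_mul (a b c d : H) (x : H ⊗[k] H) :
    (a ⊗ₜ[k] b) * ((c ⊗ₜ[k] d) * x) = ((a * c) ⊗ₜ[k] (b * d)) * x := by
  rw [← mul_assoc, Algebra.TensorProduct.tmul_mul_tmul]

/-- `h ↦ h ⊗ 1` -/
abbrev inl (k H : Type) [Field k] [Ring H] [Algebra k H] : H →ₐ[k] H ⊗[k] H :=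
  Algebra.TensorProduct.includeLeft

/-- `h ↦ 1 ⊗ h` -/
abbrev inr (k H : Type) [Field k] [Ring H] [Algebra k H] : H →ₐ[k] H ⊗[k] H :=
  Algebra.TensorProduct.includeRight

/-- `a ⊗ b ⊗ c ↦ S(b) α c ⊗ S(a)` -/
def alphaForm : H ⊗[k] (H ⊗[k] H) →ₗ[k] H ⊗[k] H :=
  conv (Q.push (inr k H))
    (conv (Q.push (inl k H)) (lscale (inl k H Q.α) (inl k H).toLinearMap))

/-- `a ⊗ b ⊗ c ↦ S(c) ⊗ a β S(b)` -/
def betaForm : H ⊗[k] (H ⊗[k] H) →ₗ[k] H ⊗[k] H :=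
  conv (inr k H).toLinearMap
    (conv (lscale (inr k H Q.β) (Q.push (inr k H))) (Q.push (inl k H)))

@[simp]
theorem alphaForm_tmul (a b c : H) :
    Q.alphaForm (a ⊗ₜ (b ⊗ₜ c)) = (Q.S b * (Q.α * c)) ⊗ₜ Q.S a := by
  simp [alphaForm]

@[simp]
theorem betaForm_tmul (a b c : H) :
    Q.betaForm (a ⊗ₜ (b ⊗ₜ c)) = Q.S c ⊗ₜ (a * (Q.β * Q.S b)) := by
  simp [betaForm]

theorem alphaForm_mul_regroup (M : H ⊗[k] (H ⊗[k] H)) (s : H ⊗[k] H) (h : H) :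
    Q.alphaForm (M * regroup k H H (s ⊗ₜ h)) = Q.antiSwap s * (Q.alphaForm M * inl k H h) := by
  induction s using induction_tmul with
  | tmul u v =>
    induction M using induction_tmul₃ with
    | tmul a b c => simp [regroup_tmul, Q.S_mul, mul_assoc]
    | add s t hs ht => simp only [map_add, add_mul, mul_add, hs, ht]
  | add s t hs ht => simp only [map_add, add_mul, mul_add, TensorProduct.add_tmul, hs, ht]

theorem betaForm_tmul_mul (M : H ⊗[k] (H ⊗[k] H)) (s : H ⊗[k] H) (h : H) :
    Q.betaForm ((h ⊗ₜ s) * M) = inr k H h * (Q.betaForm M * Q.antiSwap s) := by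
  induction s using induction_tmul with
  | tmul u v =>
    induction M using induction_tmul₃ with
    | tmul a b c => simp [Q.S_mul, mul_assoc]
    | add s t hs ht => simp only [map_add, add_mul, mul_add, hs, ht]
  | add s t hs ht => simp only [map_add, add_mul, mul_add, TensorProduct.tmul_add, hs, ht]

theorem alphaForm_comulR_mul (M : H ⊗[k] (H ⊗[k] H)) (s : H ⊗[k] H) :
    Q.alphaForm (Q.comulR s * M) = Q.alphaForm M * inr k H (Q.S (Q.counitR s)) := by
  induction s using induction_tmul with
  | tmul u v =>
    induction M using induction_tmul₃ with
    | tmul a b c =>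
      have h := (Q.isLeftAntipodal_push (inl k H)).conv_comul_mul v (b ⊗ₜ c)
      rw [comulR_tmul, Algebra.TensorProduct.tmul_mul_tmul, alphaForm, conv_tmul, h]
      simp [Q.S_mul]
    | add s t hs ht => simp only [map_add, add_mul, mul_add, hs, ht]
  | add s t hs ht => simp only [map_add, add_mul, mul_add, hs, ht]

theorem betaForm_mul_comulL (M : H ⊗[k] (H ⊗[k] H)) (s : H ⊗[k] H) :
    Q.betaForm (M * Q.comulL s) = inl k H (Q.S (Q.counitL H s)) * Q.betaForm M := by
  induction s using induction_tmul with
  | tmul u v =>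
    induction M using induction_tmul₃ with
    | tmul a b c =>
      have h := (Q.isRightAntipodal_push (inr k H)).conv_mul_comul u (a ⊗ₜ b)
      rw [comulL_tmul, ← regroup_tmul, ← regroup_mul, betaForm, conv_regroup, h]
      simp [regroup_tmul, Q.S_mul]
    | add s t hs ht => simp only [map_add, add_mul, mul_add, hs, ht]
  | add s t hs ht => simp only [map_add, add_mul, mul_add, hs, ht]

/-- `∑ S(X²) α X³ ⊗ S(X¹)` -/
def alphaTwo : H ⊗[k] H := Q.alphaForm Q.assoc

/-- `∑ S(X³) ⊗ X¹ β S(X²)` -/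
def betaTwo : H ⊗[k] H := Q.betaForm Q.assoc

theorem conv_antiComul_alphaTwo (h : H) :
    conv Q.antiComul (lscale Q.alphaTwo (inl k H).toLinearMap) (Q.Δmap h)
      = Q.alphaTwo * inr k H (Q.S h) := by
  have hL (s : H ⊗[k] H) : Q.alphaForm (Q.assoc * Q.comulL s)
      = conv Q.antiComul (lscale Q.alphaTwo (inl k H).toLinearMap) s := by
    induction s using induction_tmul with
    | tmul u v => rw [comulL_tmul, alphaForm_mul_regroup, conv_tmul]; rfl
    | add s t hs ht => simp only [map_add, mul_add, hs, ht]
  rw [← hL, ← Q.coassoc, alphaForm_comulR_mul, counitR_comul, alphaTwo]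

theorem conv_betaTwo_antiComul (h : H) :
    conv (inr k H).toLinearMap (lscale Q.betaTwo Q.antiComul) (Q.Δmap h)
      = inl k H (Q.S h) * Q.betaTwo := by
  have hR (s : H ⊗[k] H) : Q.betaForm (Q.comulR s * Q.assoc)
      = conv (inr k H).toLinearMap (lscale Q.betaTwo Q.antiComul) s := by
    induction s using induction_tmul with
    | tmul u v => rw [comulR_tmul, betaForm_tmul_mul, conv_tmul]; rfl
    | add s t hs ht => simp only [map_add, add_mul, hs, ht]
  rw [← hR, Q.coassoc, betaForm_mul_comulL, counitL_comul, betaTwo]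

theorem bridge_alphaTwo :
    Q.bridge (inl k H) Q.antiComul Q.alphaTwo (inl k H Q.β) (Q.push (inl k H)) = 1 := by
  have h₁ (P N : H ⊗[k] (H ⊗[k] H)) :
      conv (Q.push (inr k H)) (conv (Q.push (inl k H)) (conv
          (lscale (inl k H Q.α) (inl k H).toLinearMap) (lscale (inl k H Q.β) (Q.push (inl k H)))))
          (padR k H P * Q.comul₁ N)
        = conv Q.antiComul (conv (lscale (Q.alphaForm P) (inl k H).toLinearMap)
          (lscale (inl k H Q.β) (Q.push (inl k H)))) N := by
    induction N using induction_tmul₃ with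
    | tmul u v w =>
      rw [comul₁_tmul, conv_tmul, antiComul_apply]
      generalize Q.Δmap u = s
      induction s using induction_tmul with
      | tmul m n =>
        induction P using induction_tmul₃ with
        | tmul a b c => simp [regroup_tmul, Q.S_mul, mul_assoc]
        | add s t hs ht =>
          simp only [map_add, add_mul, hs, ht, conv_tmul, mul_add, lscale_apply]
      | add s t hs ht => simp only [map_add, add_mul, mul_add, TensorProduct.add_tmul, hs, ht]
    | add s t hs ht => simp only [map_add, mul_add, hs, ht]
  have hl := Q.isLeftAntipodal_push (inl k H)
  have hr := Q.isRightAntipodal_push (inl k H)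
  have h₂ := h₁ Q.assoc Q.assocInv
  rw [Q.padR_mul_comul₁_inv, hl.conv_comul₂_mul _ _ (Q.map_assocInv Q.counit₂_assoc),
    hr.conv_mul_comul₃ _ _ _ Q.counit₃_assoc, padL_apply, conv_tmul] at h₂
  refine h₂.symm.trans ?_
  rw [(Q.isAnti_push _).map_one, one_mul]
  exact Q.bridge_push (inl k H)

theorem bridge_betaTwo :
    Q.bridge (inr k H) (Q.push (inr k H)) (inr k H Q.α) Q.betaTwo Q.antiComul = 1 := by
  have h₁ (P M : H ⊗[k] (H ⊗[k] H)) :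
      conv (Q.push (inr k H)) (conv (lscale (inr k H Q.α) (inr k H).toLinearMap)
          (conv (lscale (inr k H Q.β) (Q.push (inr k H))) (Q.push (inl k H))))
          (Q.comul₃ P * padL k H M)
        = conv (Q.push (inr k H)) (conv (lscale (inr k H Q.α) (inr k H).toLinearMap)
          (lscale (Q.betaForm M) Q.antiComul)) P := by
    induction P using induction_tmul₃ with
    | tmul u v w =>
      rw [comul₃_tmul, comulR_tmul, conv_tmul, conv_tmul, lscale_apply, lscale_apply,
        antiComul_apply]
      generalize Q.Δmap w = s
      induction s using induction_tmul with
      | tmul m n =>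
        induction M using induction_tmul₃ with
        | tmul a b c => simp [Q.S_mul, mul_assoc]
        | add s t hs ht => simp only [map_add, add_mul, hs, ht, mul_add]
      | add s t hs ht => simp only [map_add, add_mul, mul_add, TensorProduct.tmul_add, hs, ht]
    | add s t hs ht => simp only [map_add, add_mul, hs, ht]
  have hl := Q.isLeftAntipodal_push (inr k H)
  have hr := Q.isRightAntipodal_push (inr k H)
  have hR (P : H ⊗[k] (H ⊗[k] H)) :
      conv (Q.push (inr k H)) (conv (lscale (inr k H Q.α) (inr k H).toLinearMap)
          (conv (lscale (inr k H Q.β) (Q.push (inr k H))) (Q.push (inl k H)))) (padR k H P)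
        = conv (Q.push (inr k H)) (conv (lscale (inr k H Q.α) (inr k H).toLinearMap)
          (lscale (inr k H Q.β) (Q.push (inr k H)))) P := by
    induction P using induction_tmul₃ with
    | tmul a b c => simp [Q.S_one, ← Algebra.TensorProduct.one_def]
    | add s t hs ht => simp only [map_add, hs, ht]
  have h₂ := h₁ Q.assocInv Q.assoc
  rw [Q.comul₃_inv_mul_padL, hr.conv_mul_comul₂ _ _ _ (Q.map_assocInv Q.counit₂_assoc),
    hl.conv_comul₁_mul _ Q.counitL_assoc, hR] at h₂
  exact h₂.symm.trans (Q.bridge_push (inr k H))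

end Twist

section Drinfeld

set_option maxSynthPendingDepth 6

/-- `a ⊗ b ⊗ c ↦ (S a₂ ⊗ S a₁) (∑ S(X²) α X³ ⊗ S(X¹)) (b ⊗ α c)` -/
def gammaForm : H ⊗[k] (H ⊗[k] H) →ₗ[k] H ⊗[k] H :=
  conv Q.antiComul (conv (lscale Q.alphaTwo (inl k H).toLinearMap)
    (lscale (inr k H Q.α) (inr k H).toLinearMap))

/-- `a ⊗ b ⊗ c ↦ (a β ⊗ b) (∑ S(X³) ⊗ X¹ β S(X²)) (S c₂ ⊗ S c₁)` -/
def deltaForm : H ⊗[k] (H ⊗[k] H) →ₗ[k] H ⊗[k] H :=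
  conv (inl k H).toLinearMap (conv (lscale (inl k H Q.β) (inr k H).toLinearMap)
    (lscale Q.betaTwo Q.antiComul))

theorem gammaForm_tmul (a b c : H) :
    Q.gammaForm (a ⊗ₜ (b ⊗ₜ c)) = Q.antiComul a * (Q.alphaTwo * (b ⊗ₜ (Q.α * c))) := by
  simp [gammaForm, mul_assoc]

theorem deltaForm_tmul (a b c : H) :
    Q.deltaForm (a ⊗ₜ (b ⊗ₜ c)) = ((a * Q.β) ⊗ₜ b) * (Q.betaTwo * Q.antiComul c) := by
  simp [deltaForm, tmul_mul_tmul_mul]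

/-- The element `γ` entering the Drinfeld twist. -/
def gamma : H ⊗[k] H := Q.gammaForm Q.assocInv

/-- The element `δ` entering the inverse of the Drinfeld twist. -/
def delta : H ⊗[k] H := Q.deltaForm Q.assocInv

theorem gammaForm_mul_tmul (P : H ⊗[k] (H ⊗[k] H)) (u : H) (t : H ⊗[k] H) :
    Q.gammaForm (P * (u ⊗ₜ t)) = Q.antiComul u * (Q.gammaForm P * t) := by
  induction t using induction_tmul with
  | tmul v w =>
    induction P using induction_tmul₃ with
    | tmul a b c => simp [gammaForm_tmul, Q.isAnti_antiComul.map_mul, mul_assoc]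
    | add s t hs ht => simp only [map_add, add_mul, mul_add, hs, ht]
  | add s t hs ht => simp only [map_add, mul_add, TensorProduct.tmul_add, hs, ht]

theorem gammaForm_regroup_mul (h v a b c : H) :
    Q.gammaForm (regroup k H H (Q.Δmap h ⊗ₜ v) * (a ⊗ₜ (b ⊗ₜ c)))
      = Q.antiComul a * (Q.alphaTwo * (b ⊗ₜ (Q.S h * (Q.α * (v * c))))) := by
  rw [← regroup_tmul, ← regroup_mul, gammaForm, conv_regroup, Q.isAnti_antiComul.conv_mul_tmul,
    conv_antiComul_alphaTwo]
  simp [mul_assoc]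

theorem isLeftAntipodal_antiComul : Q.IsLeftAntipodal Q.Δmap Q.antiComul Q.gamma where
  toIsAnti := Q.isAnti_antiComul
  left h := by
    have hR (s : H ⊗[k] H) : Q.gammaForm (Q.assocInv * Q.comulR s)
        = conv Q.antiComul (lscale Q.gamma Q.Δmap.toLinearMap) s := by
      induction s using induction_tmul with
      | tmul u v => simp [gammaForm_mul_tmul, gamma]
      | add s t hs ht => simp only [map_add, mul_add, hs, ht]
    have hL (P : H ⊗[k] (H ⊗[k] H)) :
        Q.gammaForm (Q.comulL (Q.Δmap h) * P) = Q.ε h • Q.gammaForm P := by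
      induction P using induction_tmul₃ with
      | tmul a b c =>
        have hs (s : H ⊗[k] H) : Q.gammaForm (Q.comulL s * (a ⊗ₜ (b ⊗ₜ c)))
            = Q.antiComul a * (Q.alphaTwo * (b ⊗ₜ
              (conv Q.S (lscale Q.α LinearMap.id) s * c))) := by
          induction s using induction_tmul with
          | tmul u v =>
            rw [comulL_tmul, gammaForm_regroup_mul]
            simp [mul_assoc]
          | add s t hs ht =>
            simp only [map_add, add_mul, mul_add, TensorProduct.tmul_add, hs, ht]
        have hα : conv Q.S (lscale Q.α LinearMap.id) (Q.Δmap h) = Q.ε h • Q.α := by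
          simp [Q.Δ_eq h, ← Q.antipode₁ h, mul_assoc]
        rw [hs, hα, gammaForm_tmul]
        simp
      | add s t hs ht => simp only [map_add, mul_add, smul_add, hs, ht]
    rw [← hR, ← Q.coassoc_inv, hL, gamma]

theorem lTensor_gammaForm_padL (P N : H ⊗[k] (H ⊗[k] H)) :
    LinearMap.lTensor H Q.gammaForm (padL k H P * Q.comul₃ N)
      = LinearMap.lTensor H
        (conv Q.antiComul (lscale (Q.gammaForm P) Q.Δmap.toLinearMap)) N := by
  induction N using induction_tmul₃ with
  | tmul a b c => simp [gammaForm_mul_tmul]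
  | add s t hs ht => simp only [map_add, mul_add, hs, ht]

theorem lTensor_gammaForm_comul₂ (P N : H ⊗[k] (H ⊗[k] H)) (a b c : H) :
    LinearMap.lTensor H Q.gammaForm (Q.comul₂ (a ⊗ₜ (b ⊗ₜ c)) * (padR k H P * Q.comul₁ N))
      = LinearMap.lTensor H (conv Q.antiComul (conv (lscale Q.alphaTwo (inl k H).toLinearMap)
          (lscale (inr k H (Q.S b * (Q.α * c))) (inr k H).toLinearMap)))
        ((a ⊗ₜ 1) * (padR k H P * Q.comul₁ N)) := by
  generalize padR k H P * Q.comul₁ N = M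
  induction M using induction_tmul₄ with
  | tmul d e f g =>
    rw [comul₂_tmul, comulL_tmul, Algebra.TensorProduct.tmul_mul_tmul,
      Algebra.TensorProduct.tmul_mul_tmul, LinearMap.lTensor_tmul, LinearMap.lTensor_tmul,
      gammaForm_regroup_mul]
    simp [mul_assoc]
  | add s t hs ht => simp only [map_add, mul_add, hs, ht]

theorem bridge_gamma_delta :
    Q.bridge Q.Δmap Q.antiComul Q.gamma Q.delta Q.antiComul = 1 := by
  let K := conv Q.antiComul (conv (lscale Q.alphaTwo (inl k H).toLinearMap)
    (conv (lscale (Q.β ⊗ₜ Q.α) (inr k H).toLinearMap) (lscale Q.betaTwo Q.antiComul)))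
  have hK (a b c d : H) : K (a ⊗ₜ (b ⊗ₜ (c ⊗ₜ d)))
      = Q.antiComul a * (Q.alphaTwo * (((b * Q.β) ⊗ₜ (Q.α * c))
        * (Q.betaTwo * Q.antiComul d))) := by
    simp [K, mul_assoc, tmul_mul_tmul_mul]
  have h₁ (P M N : H ⊗[k] (H ⊗[k] H)) : K (padR k H P * Q.comul₂ M * padL k H N)
      = conv Q.antiComul (conv (lscale (Q.gammaForm P) Q.Δmap.toLinearMap)
        (lscale (Q.deltaForm N) Q.antiComul)) M := by
    induction M using induction_tmul₃ with
    | tmul u v w =>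
      rw [comul₂_tmul, comulL_tmul, conv_tmul, conv_tmul]
      simp only [lscale_apply, AlgHom.toLinearMap_apply]
      generalize Q.Δmap v = s
      induction s using induction_tmul with
      | tmul m n =>
        induction P using induction_tmul₃ with
        | tmul a b c =>
          induction N using induction_tmul₃ with
          | tmul d e f =>
            simp [regroup_tmul, hK, gammaForm_tmul, deltaForm_tmul, mul_assoc, tmul_mul_tmul_mul,
              Q.isAnti_antiComul.map_mul]
          | add s t hs ht => simp only [map_add, add_mul, mul_add, hs, ht]
        | add s t hs ht => simp only [map_add, add_mul, mul_add, hs, ht]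
      | add s t hs ht =>
        simp only [map_add, add_mul, mul_add, TensorProduct.add_tmul, TensorProduct.tmul_add, hs,
          ht]
    | add s t hs ht => simp only [map_add, add_mul, mul_add, hs, ht]
  have h₂ (P N : H ⊗[k] (H ⊗[k] H)) : K (Q.comul₁ P * Q.comul₃ N)
      = conv Q.antiComul (conv (lscale Q.alphaTwo (inl k H).toLinearMap)
          (lscale (inl k H Q.β) (Q.push (inl k H)))) N
        * conv (Q.push (inr k H)) (conv (lscale (inr k H Q.α) (inr k H).toLinearMap)
          (lscale Q.betaTwo Q.antiComul)) P := by
    induction P using induction_tmul₃ with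
    | tmul p b c =>
      induction N using induction_tmul₃ with
      | tmul d e f =>
        rw [comul₁_tmul, comul₃_tmul, comulR_tmul, ← regroup_tmul d e, ← regroup_mul,
          conv_regroup, Q.isAnti_antiComul.conv_mul_tmul, conv_lscale_left,
          Q.isAnti_antiComul.conv_tmul_mul, conv_antiComul_alphaTwo, conv_betaTwo_antiComul]
        simp [mul_assoc, tmul_mul_tmul_mul]
      | add s t hs ht => simp only [map_add, add_mul, mul_add, hs, ht]
    | add s t hs ht => simp only [map_add, add_mul, mul_add, hs, ht]
  have h := h₁ Q.assocInv Q.assocInv Q.assocInv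
  rw [Q.pentagon_inv, h₂] at h
  refine h.symm.trans ?_
  have h₃ := congrArg₂ (· * ·) Q.bridge_alphaTwo Q.bridge_betaTwo
  exact h₃.trans (mul_one 1)

/-- The inverse of the Drinfeld twist. -/
def twistInv : H ⊗[k] H :=
  Q.bridge Q.Δmap (Q.push Q.Δmap) (Q.Δmap Q.α) Q.delta Q.antiComul

theorem antiComul_Sinv (h : H) :
    Q.antiComul (Q.Sinv (Q.α * h)) = Q.gamma * Q.Δmap h * Q.twistInv :=
  Q.isLeftAntipodal_antiComul.apply_eq (Q.isRightAntipodal_push Q.Δmap)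
    (Q.isLeftAntipodal_push Q.Δmap) (Q.conv_push_assoc Q.Δmap) Q.bridge_gamma_delta
    (by rw [push_apply, Q.S_Sinv, map_mul])

end Drinfeld

section Components

set_option maxSynthPendingDepth 6

theorem antiComul_eq_sum (h : H) :
    Q.antiComul h = ∑ j, Q.S (Q.Δ2 h j) ⊗ₜ[k] Q.S (Q.Δ1 h j) := by
  rw [antiComul_apply, Q.Δ_eq h, map_sum]
  rfl

theorem S_q2 (i : Q.I) : Q.S (Q.q2 i) = Q.S (Q.X2 i) * (Q.α * Q.X3 i) := by
  rw [q2, Q.S_mul, Q.S_Sinv]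

theorem alphaTwo_eq_sum :
    Q.alphaTwo = ∑ i, Q.S (Q.q2 i) ⊗ₜ[k] Q.S (Q.q1 i) := by
  simp only [alphaTwo, assoc, map_sum, alphaForm_tmul, S_q2, q1]

theorem delta_eq_sum : Q.delta = ∑ t : Q.BIdx, Q.del1 t ⊗ₜ[k] Q.del2 t := by
  let U := conv (inl k H).toLinearMap (conv (lscale (inl k H Q.β) (inr k H).toLinearMap)
    (conv (lscale (inr k H Q.β) (Q.push (inr k H))) (Q.push (inl k H))))
  have hU (a b c d : H) : U (a ⊗ₜ (b ⊗ₜ (c ⊗ₜ d)))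
      = (a * Q.β * Q.S d) ⊗ₜ (b * Q.β * Q.S c) := by
    simp [U, mul_assoc]
  have h₁ (P M : H ⊗[k] (H ⊗[k] H)) : U (Q.comul₃ P * padL k H M)
      = conv (inl k H).toLinearMap (conv (lscale (inl k H Q.β) (inr k H).toLinearMap)
        (lscale (Q.betaForm M) Q.antiComul)) P := by
    induction P using induction_tmul₃ with
    | tmul u v w =>
      rw [comul₃_tmul, comulR_tmul, conv_tmul, conv_tmul, lscale_apply, lscale_apply,
        antiComul_apply]
      generalize Q.Δmap w = s
      induction s using induction_tmul with
      | tmul m n =>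
        induction M using induction_tmul₃ with
        | tmul a b c => simp [hU, Q.S_mul, mul_assoc]
        | add s t hs ht => simp only [map_add, add_mul, hs, ht, mul_add]
      | add s t hs ht => simp only [map_add, add_mul, mul_add, TensorProduct.tmul_add, hs, ht]
    | add s t hs ht => simp only [map_add, add_mul, hs, ht]
  have h₂ : U (Q.comul₁ Q.assoc * padR k H Q.assocInv) = Q.delta := by
    rw [Q.comul₁_mul_padR_inv, (Q.isRightAntipodal_push (inr k H)).conv_mul_comul₂ _ _ _
      Q.counit₂_assoc, h₁]
    rfl
  rw [← h₂]
  simp only [assoc, assocInv, map_sum, comul₁_tmul, Q.Δ_eq, TensorProduct.sum_tmul, regroup_tmul,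
    padR_tmul, Finset.sum_mul, Finset.mul_sum, Algebra.TensorProduct.tmul_mul_tmul, mul_one, hU,
    Fintype.sum_prod_type, del1, del2, B1, B2, B3, B4]
  rw [Finset.sum_comm]
  exact Finset.sum_congr rfl fun i _ => Finset.sum_comm

theorem twistInv_eq_sum : Q.twistInv = ∑ t : Q.GIdx, Q.g1 t ⊗ₜ[k] Q.g2 t := by
  have h : Q.twistInv = ∑ a, Q.Δmap (Q.S (Q.x1 a) * Q.α * Q.x2 a)
      * (∑ t : Q.BIdx, Q.del1 t ⊗ₜ[k] Q.del2 t) * Q.antiComul (Q.x3 a) := by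
    rw [← delta_eq_sum]
    simp [twistInv, bridge, assocInv, mul_assoc]
  rw [h]
  refine Eq.trans (Finset.sum_congr rfl fun a _ => ?_) (Fintype.sum_prod_type _).symm
  rw [antiComul_eq_sum, Q.Δ_eq, Finset.sum_mul, Finset.sum_mul]
  refine Eq.trans (Finset.sum_congr rfl fun j _ => ?_) (Fintype.sum_prod_type _).symm
  rw [mul_assoc, Finset.sum_mul, Finset.mul_sum]
  refine Eq.trans (Finset.sum_congr rfl fun b _ => ?_) (Fintype.sum_prod_type _).symm
  simp only [Finset.mul_sum, Algebra.TensorProduct.tmul_mul_tmul, g1, g2, mul_assoc]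

theorem antiSwap_comul_qR :
    LinearMap.lTensor H Q.antiSwap (∑ i, Q.q1 i ⊗ₜ[k] Q.Δmap (Q.q2 i))
      = LinearMap.lTensor H (LinearMap.mulRight k Q.twistInv)
        (LinearMap.lTensor H (conv Q.antiComul (lscale Q.gamma Q.Δmap.toLinearMap)) Q.assoc) := by
  simp only [map_sum, assoc, LinearMap.lTensor_tmul, ← antiComul_apply, q1, q2,
    Q.isAnti_antiComul.map_mul, antiComul_Sinv, conv_tmul, lscale_apply, LinearMap.mulRight_apply,
    AlgHom.toLinearMap_apply, mul_assoc]

theorem lTensor_conv_antiComul_gamma :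
    LinearMap.lTensor H (conv Q.antiComul (lscale Q.gamma Q.Δmap.toLinearMap)) Q.assoc
      = ∑ iQ, ∑ iY, ∑ a, ∑ j, (Q.q1 iQ * Q.X1 iY * Q.Δ1 (Q.x1 a) j) ⊗ₜ[k]
        (Q.antiComul (Q.X2 iY * Q.Δ2 (Q.x1 a) j)
          * (Q.alphaTwo * ((Q.X3 iY * Q.x2 a) ⊗ₜ[k] (Q.S (Q.q2 iQ) * Q.x3 a)))) := by
  have h := Q.lTensor_gammaForm_padL Q.assocInv Q.assoc
  rw [Q.padL_inv_mul_comul₃, mul_assoc] at h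
  refine h.symm.trans ?_
  have hQ : Q.comul₂ Q.assoc = ∑ iQ, Q.comul₂ (Q.X1 iQ ⊗ₜ (Q.X2 iQ ⊗ₜ Q.X3 iQ)) := by
    rw [assoc, map_sum]
  rw [hQ, Finset.sum_mul, map_sum]
  refine Finset.sum_congr rfl fun iQ _ => ?_
  rw [lTensor_gammaForm_comul₂, ← S_q2]
  simp only [assoc, assocInv, map_sum, comul₁_tmul, Q.Δ_eq, TensorProduct.sum_tmul, regroup_tmul,
    padR_tmul, Finset.sum_mul, Finset.mul_sum, Algebra.TensorProduct.tmul_mul_tmul, mul_one,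
    one_mul, LinearMap.lTensor_tmul, conv_tmul, lscale_apply, AlgHom.toLinearMap_apply,
    Algebra.TensorProduct.includeLeft_apply, Algebra.TensorProduct.includeRight_apply, mul_assoc,
    q1]
  rw [eq_comm, Finset.sum_comm]
  exact Finset.sum_congr rfl fun a _ => Finset.sum_comm

theorem antiComul_mul_eq_sum (a b : H) :
    Q.antiComul (a * b) = ∑ j', ∑ jY, (Q.S (Q.Δ2 b j') * Q.S (Q.Δ2 a jY))
      ⊗ₜ[k] (Q.S (Q.Δ1 b j') * Q.S (Q.Δ1 a jY)) := by
  rw [Q.isAnti_antiComul.map_mul, antiComul_eq_sum, antiComul_eq_sum]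
  simp only [Finset.sum_mul, Finset.mul_sum, Algebra.TensorProduct.tmul_mul_tmul]
  exact Finset.sum_comm

end Components

end QuasiHopf

/-- Identity (fox): with `q_R = ∑ q¹⊗q² = ∑ Q¹⊗Q²`,
`(id⊗Δ)(q_R) = ∑ Q¹Y¹x¹₁ ⊗ S⁻¹(x³g²)Q²q¹Y²₁x¹₍₂,₁₎ ⊗ S⁻¹(Y³x²g¹)q²Y²₂x¹₍₂,₂₎`. -/
theorem comul_qR_identity {k H : Type} [Field k] [Ring H] [Algebra k H]
    (Q : QuasiHopf k H) :
    ∑ i, ∑ j, Q.q1 i ⊗ₜ[k] (Q.Δ1 (Q.q2 i) j ⊗ₜ[k] Q.Δ2 (Q.q2 i) j)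
      = ∑ iQ, ∑ iq, ∑ iY, ∑ a, ∑ c : Q.GIdx, ∑ j, ∑ j', ∑ jY,
          (Q.q1 iQ * Q.X1 iY * Q.Δ1 (Q.x1 a) j)
            ⊗ₜ[k] ((Q.Sinv (Q.x3 a * Q.g2 c) * Q.q2 iQ * Q.q1 iq
                      * Q.Δ1 (Q.X2 iY) jY * Q.Δ1 (Q.Δ2 (Q.x1 a) j) j')
              ⊗ₜ[k] (Q.Sinv (Q.X3 iY * Q.x2 a * Q.g1 c) * Q.q2 iq
                      * Q.Δ2 (Q.X2 iY) jY * Q.Δ2 (Q.Δ2 (Q.x1 a) j) j')) := by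
  have hinj : Function.Injective (LinearMap.lTensor H Q.antiSwap) :=
    Module.Flat.lTensor_preserves_injective_linearMap _ Q.antiSwap_injective
  simp only [← TensorProduct.tmul_sum, ← Q.Δ_eq]
  apply hinj
  rw [Q.antiSwap_comul_qR, Q.lTensor_conv_antiComul_gamma]
  simp only [map_sum, LinearMap.lTensor_tmul, QuasiHopf.antiSwap_tmul,
    LinearMap.mulRight_apply]
  refine Finset.sum_congr rfl fun iQ _ => Eq.trans ?_ Finset.sum_comm
  refine Finset.sum_congr rfl fun iY _ => Eq.trans ?_ Finset.sum_comm
  refine Finset.sum_congr rfl fun a _ =>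
    Eq.trans ?_ (Finset.sum_congr rfl fun iq _ => Finset.sum_comm)
  refine Eq.trans (Finset.sum_congr rfl fun j _ => ?_) Finset.sum_comm
  have key (iq : Q.I) (c : Q.GIdx) :
      ∑ j', ∑ jY, Q.S (Q.Sinv (Q.X3 iY * Q.x2 a * Q.g1 c) * Q.q2 iq
                      * Q.Δ2 (Q.X2 iY) jY * Q.Δ2 (Q.Δ2 (Q.x1 a) j) j')
              ⊗ₜ[k] Q.S (Q.Sinv (Q.x3 a * Q.g2 c) * Q.q2 iQ * Q.q1 iq
                      * Q.Δ1 (Q.X2 iY) jY * Q.Δ1 (Q.Δ2 (Q.x1 a) j) j')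
        = Q.antiComul (Q.X2 iY * Q.Δ2 (Q.x1 a) j)
            * (Q.S (Q.q2 iq) ⊗ₜ[k] Q.S (Q.q1 iq)
              * ((Q.X3 iY * Q.x2 a) ⊗ₜ[k] (Q.S (Q.q2 iQ) * Q.x3 a)))
            * (Q.g1 c ⊗ₜ[k] Q.g2 c) := by
    rw [Q.antiComul_mul_eq_sum]
    simp only [Finset.sum_mul, Algebra.TensorProduct.tmul_mul_tmul, Q.S_mul, Q.S_Sinv, mul_assoc]
  refine Eq.trans ?_ (Finset.sum_congr rfl fun iq _ => Finset.sum_congr rfl fun c _ =>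
    congrArg _ (key iq c).symm)
  simp only [← TensorProduct.tmul_sum, ← Finset.mul_sum, ← Finset.sum_mul,
    ← Q.twistInv_eq_sum, ← Q.alphaTwo_eq_sum]
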